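/- Let T > 0 and let f, g ∈ L¹((0,T); ℝ). Assume that for every φ ∈ C_c^∞((0,T)) with φ ≥ 0 one has −∫₀ᵀ φ′(t) g(t) dt ≤ ∫₀ᵀ φ(t) f(t) dt. Then there exists a Lebesgue-null set N ⊂ (0,T) such that for all s, t ∈ (0,T) \ N with s < t one has g(t) − g(s) ≤ ∫ₛᵗ f(τ) dτ. -/

import Mathlib

open MeasureTheory Set intervalIntegral

open Filter Topology Convolution

theorem vl_phi_deriv (ρ : ℝ → ℝ) (hc : Continuous ρ) (s t τ : ℝ) :
    HasDerivAt (fun τ => ∫ x in (s - τ)..(t - τ), ρ x) (ρ (s - τ) - ρ (t - τ)) τ := by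
  have h1 : ∀ y, HasDerivAt (fun u => ∫ x in (0:ℝ)..u, ρ x) (ρ y) y := fun y =>
    integral_hasDerivAt_right (hc.intervalIntegrable _ _)
      hc.stronglyMeasurable.stronglyMeasurableAtFilter hc.continuousAt
  have h2 : ∀ a, HasDerivAt (fun τ => ∫ x in (0:ℝ)..(a - τ), ρ x) (ρ (a - τ) * (-1)) τ := by
    intro a
    have h3 : HasDerivAt (fun τ : ℝ => a - τ) (-1) τ := by
      simpa using (hasDerivAt_id τ).const_sub a
    exact (h1 (a - τ)).comp τ h3
  have h4 := (h2 t).sub (h2 s)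
  have e1 : (fun τ => ∫ x in (s - τ)..(t - τ), ρ x) =
      (fun τ => ∫ x in (0:ℝ)..(t - τ), ρ x) - fun τ => ∫ x in (0:ℝ)..(s - τ), ρ x := by
    funext x
    simp only [Pi.sub_apply]
    rw [integral_interval_sub_left (hc.intervalIntegrable _ _) (hc.intervalIntegrable _ _)]
  have e2 : ρ (s - τ) - ρ (t - τ) = ρ (t - τ) * (-1) - ρ (s - τ) * (-1) := by ring
  rw [e1, e2]
  exact h4

theorem vl_phi_smooth (ρ : ℝ → ℝ) (hc : ContDiff ℝ (⊤ : ℕ∞) ρ) (s t : ℝ) :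
    ContDiff ℝ (⊤ : ℕ∞) (fun τ => ∫ x in (s - τ)..(t - τ), ρ x) := by
  rw [contDiff_infty_iff_deriv]
  refine ⟨fun τ => (vl_phi_deriv ρ hc.continuous s t τ).differentiableAt, ?_⟩
  have : deriv (fun τ => ∫ x in (s - τ)..(t - τ), ρ x) = fun τ => ρ (s - τ) - ρ (t - τ) :=
    funext fun τ => (vl_phi_deriv ρ hc.continuous s t τ).deriv
  rw [this]
  fun_prop

theorem vl_phi_zero (ρ : ℝ → ℝ) (ε s t τ : ℝ) (hst : s < t)
    (hs : ∀ x, ε ≤ |x| → ρ x = 0) (h : ε ≤ s - τ ∨ ε ≤ τ - t) :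
    ∫ x in (s - τ)..(t - τ), ρ x = 0 := by
  rw [integral_congr (g := fun _ => (0:ℝ))]
  · simp
  · intro x hx
    rw [uIcc_of_le (by linarith)] at hx
    apply hs
    rcases h with h | h
    · exact le_trans (by linarith [hx.1]) (le_abs_self x)
    · exact le_trans (by linarith [hx.2]) (neg_le_abs x)

theorem vl_phi_one (ρ : ℝ → ℝ) (ε s t τ : ℝ)
    (hs : ∀ x, ε ≤ |x| → ρ x = 0) (hi : ∫ x, ρ x = 1) (h : ε < τ - s) (h' : ε < t - τ) :
    ∫ x in (s - τ)..(t - τ), ρ x = 1 := by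
  rw [integral_eq_integral_of_support_subset, hi]
  intro x hx
  have : |x| < ε := by
    by_contra hh
    exact hx (hs x (not_lt.1 hh))
  rw [abs_lt] at this
  constructor <;> linarith

theorem vl_phi_nonneg (ρ : ℝ → ℝ) (h0 : ∀ x, 0 ≤ ρ x) (s t τ : ℝ) (hst : s < t) :
    0 ≤ ∫ x in (s - τ)..(t - τ), ρ x :=
  integral_nonneg (by linarith) fun x _ => h0 x

theorem vl_phi_le (ρ : ℝ → ℝ) (h0 : ∀ x, 0 ≤ ρ x) (hi : ∫ x, ρ x = 1)
    (hI : Integrable ρ) (s t τ : ℝ) (hst : s < t) :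
    ∫ x in (s - τ)..(t - τ), ρ x ≤ 1 := by
  rw [integral_of_le (by linarith), ← hi]
  exact setIntegral_le_integral hI (Eventually.of_forall h0)

/-- **Lemma 3.1.** Let `T > 0` and `f, g ∈ L¹((0,T); ℝ)`. If for every nonnegative
`φ ∈ C_c^∞((0,T))` one has `-∫₀ᵀ φ'(t) g(t) dt ≤ ∫₀ᵀ φ(t) f(t) dt`, then there is a
Lebesgue-null set `N ⊆ (0,T)` such that for all `s, t ∈ (0,T) \ N` with `s < t`,
`g(t) - g(s) ≤ ∫ₛᵗ f(τ) dτ`. -/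
theorem variational_lemma (T : ℝ) (hT : 0 < T) (f g : ℝ → ℝ)
    (hf : IntegrableOn f (Set.Ioo 0 T)) (hg : IntegrableOn g (Set.Ioo 0 T))
    (hvar : ∀ φ : ℝ → ℝ, ContDiff ℝ (⊤ : ℕ∞) φ → HasCompactSupport φ →
      tsupport φ ⊆ Set.Ioo 0 T → (∀ t, 0 ≤ φ t) →
      -(∫ t in Set.Ioo 0 T, deriv φ t * g t) ≤ ∫ t in Set.Ioo 0 T, φ t * f t) :
    ∃ N : Set ℝ, N ⊆ Set.Ioo 0 T ∧ volume N = 0 ∧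
      ∀ s t : ℝ, s ∈ Set.Ioo 0 T \ N → t ∈ Set.Ioo 0 T \ N → s < t →
        g t - g s ≤ ∫ τ in s..t, f τ := by
  let b : ℕ → ContDiffBump (0 : ℝ) := fun n =>
    ⟨1 / ((n:ℝ) + 1), 2 * (1 / ((n:ℝ) + 1)), by positivity, by
      have : 0 < 1 / ((n:ℝ) + 1) := by positivity
      linarith⟩
  let G : ℝ → ℝ := (Ioo 0 T).indicator g
  have hG : Integrable G := (integrable_indicator_iff measurableSet_Ioo).2 hg
  have hr : Tendsto (fun n => (b n).rOut) atTop (𝓝 0) := by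
    have := (tendsto_one_div_add_atTop_nhds_zero_nat (𝕜 := ℝ)).const_mul 2
    simpa only [mul_zero] using this
  have hconv := ContDiffBump.ae_convolution_tendsto_right_of_locallyIntegrable (μ := volume)
    (φ := b) (l := atTop) (K := 2) hr (Eventually.of_forall fun n => le_rfl) hG.locallyIntegrable
  let ρ : ℕ → ℝ → ℝ := fun n => (b n).normed volume
  have hρc : ∀ n, ContDiff ℝ (⊤ : ℕ∞) (ρ n) := fun n => (b n).contDiff_normed
  have hρ0 : ∀ n x, 0 ≤ ρ n x := fun n x => (b n).nonneg_normed x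
  have hρ1 : ∀ n, ∫ x, ρ n x = 1 := fun n => (b n).integral_normed
  have hρI : ∀ n, Integrable (ρ n) := fun n => (b n).integrable_normed
  have hρs : ∀ n x, (b n).rOut ≤ |x| → ρ n x = 0 := by
    intro n x hx
    have h := (b n).support_normed_eq (μ := volume)
    by_contra hne
    have : x ∈ Function.support ((b n).normed volume) := hne
    rw [h, Metric.mem_ball, dist_zero_right, Real.norm_eq_abs] at this
    linarith
  have hρb : ∀ n a, Integrable (fun τ => ρ n (a - τ) * g τ) (volume.restrict (Ioo 0 T)) := by
    intro n a
    obtain ⟨C, hC⟩ := (b n).hasCompactSupport_normed (μ := volume) |>.exists_bound_of_continuous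
      (hρc n).continuous
    refine Integrable.bdd_mul (c := C) hg ?_ (Eventually.of_forall fun x => hC _)
    exact ((hρc n).continuous.comp (continuous_const.sub continuous_id)).aestronglyMeasurable
  have hconveq : ∀ n a, (((b n).normed volume) ⋆[ContinuousLinearMap.lsmul ℝ ℝ, volume] G) a
      = ∫ τ in Ioo 0 T, ρ n (a - τ) * g τ := by
    intro n a
    rw [convolution_eq_swap, ← MeasureTheory.integral_indicator measurableSet_Ioo]
    congr 1
    funext τ
    by_cases h : τ ∈ Ioo 0 T <;> simp [G, h, ρ]
  refine ⟨Ioo 0 T ∩ {x | ¬ Tendsto (fun n => (((b n).normed volume)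
      ⋆[ContinuousLinearMap.lsmul ℝ ℝ, volume] G) x) atTop (𝓝 (G x))}, inter_subset_left,
      measure_mono_null inter_subset_right (ae_iff.1 hconv), ?_⟩
  intro s t hs ht hst
  have key : ∀ a, a ∈ Ioo 0 T \ (Ioo 0 T ∩ {x | ¬ Tendsto (fun n => (((b n).normed volume)
      ⋆[ContinuousLinearMap.lsmul ℝ ℝ, volume] G) x) atTop (𝓝 (G x))}) →
      Tendsto (fun n => ∫ τ in Ioo 0 T, ρ n (a - τ) * g τ) atTop (𝓝 (g a)) := by
    intro a ha
    have h1 : Tendsto (fun n => (((b n).normed volume)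
      ⋆[ContinuousLinearMap.lsmul ℝ ℝ, volume] G) a) atTop (𝓝 (G a)) := by
      by_contra h
      exact ha.2 ⟨ha.1, h⟩
    simp only [hconveq] at h1
    simpa only [G, indicator_of_mem ha.1] using h1
  have hL := (key t ht).sub (key s hs)
  have hR : Tendsto (fun n => ∫ τ in Ioo 0 T, (∫ x in (s - τ)..(t - τ), ρ n x) * f τ) atTop
      (𝓝 (∫ τ in Ioo 0 T, (Ioc s t).indicator f τ)) := by
    refine tendsto_integral_of_dominated_convergence (fun τ => ‖f τ‖) ?_ hf.norm ?_ ?_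
    · intro n
      exact (vl_phi_smooth _ (hρc n) s t).continuous.aestronglyMeasurable.mul
        hf.aestronglyMeasurable
    · intro n
      refine Eventually.of_forall fun τ => ?_
      rw [norm_mul, Real.norm_eq_abs, abs_of_nonneg (vl_phi_nonneg _ (hρ0 n) s t τ hst)]
      exact mul_le_of_le_one_left (norm_nonneg _) (vl_phi_le _ (hρ0 n) (hρ1 n) (hρI n) s t τ hst)
    · apply ae_restrict_of_ae
      filter_upwards [(Set.finite_singleton s).countable.ae_notMem volume,
        (Set.finite_singleton t).countable.ae_notMem volume] with τ h1 h2
      have h1 : τ ≠ s := h1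
      have h2 : τ ≠ t := h2
      apply tendsto_const_nhds.congr'
      have e1 := hr.eventually (gt_mem_nhds (abs_pos.2 (sub_ne_zero.2 h1)))
      have e2 := hr.eventually (gt_mem_nhds (abs_pos.2 (sub_ne_zero.2 h2)))
      filter_upwards [e1, e2] with n e1 e2
      rcases lt_or_gt_of_ne h1 with h | h
      · rw [vl_phi_zero _ _ s t τ hst (hρs n), indicator_of_notMem, zero_mul]
        · exact fun hh => by linarith [hh.1]
        · left; rw [abs_of_neg (by linarith)] at e1; linarith
      · rcases lt_or_gt_of_ne h2 with h' | h'
        · rw [abs_of_pos (by linarith)] at e1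
          rw [abs_of_neg (by linarith)] at e2
          rw [vl_phi_one _ _ s t τ (hρs n) (hρ1 n) e1 (by linarith), indicator_of_mem, one_mul]
          exact ⟨h, h'.le⟩
        · rw [vl_phi_zero _ _ s t τ hst (hρs n), indicator_of_notMem, zero_mul]
          · exact fun hh => by linarith [hh.2]
          · right; rw [abs_of_pos (by linarith)] at e2; linarith
  have hfin : ∫ τ in Ioo 0 T, (Ioc s t).indicator f τ = ∫ τ in s..t, f τ := by
    have hI : Ioc s t ⊆ Ioo 0 T := fun x hx => ⟨hs.1.1.trans hx.1, hx.2.trans_lt ht.1.2⟩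
    rw [setIntegral_indicator measurableSet_Ioc, integral_of_le hst.le, inter_eq_right.2 hI]
  rw [← hfin]
  refine le_of_tendsto_of_tendsto hL hR ?_
  have e1 := hr.eventually (gt_mem_nhds hs.1.1)
  have e2 := hr.eventually (gt_mem_nhds (sub_pos.2 ht.1.2))
  filter_upwards [e1, e2] with n e1 e2
  have hsub : tsupport (fun τ => ∫ x in (s - τ)..(t - τ), ρ n x)
      ⊆ Icc (s - (b n).rOut) (t + (b n).rOut) := by
    apply closure_minimal _ isClosed_Icc
    intro τ hτ
    by_contra hh
    apply hτ
    apply vl_phi_zero _ _ s t τ hst (hρs n)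
    by_contra! h3
    exact hh ⟨by linarith, by linarith⟩
  have := hvar _ (vl_phi_smooth _ (hρc n) s t)
    (isCompact_Icc.of_isClosed_subset (isClosed_tsupport _) hsub)
    (hsub.trans fun x hx => ⟨by linarith [hx.1], by linarith [hx.2]⟩)
    (fun τ => vl_phi_nonneg _ (hρ0 n) s t τ hst)
  refine le_trans (le_of_eq ?_) this
  simp only [(vl_phi_deriv _ (hρc n).continuous s t _).deriv, sub_mul]
  rw [MeasureTheory.integral_sub (hρb n s) (hρb n t)]
  ring
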